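/- arXiv:math/0310465 — 2 statements merged into one kernel-verified Lean document; each statement's English description precedes it below -/
import Mathlib

section
/- Take characteristics (m₀, m₁, m₂, m₃) = (0,0,0,0) (so N = 2, ρ = 3b² − 2(a+1)b + a) and assume b² − 2b + a = 0. Then for every λ ∈ ℂ the function Ψ(λ, z) = (z−b)²λ + (3a−4b)z² − 2(6a+5ab−12b)z − 3a² + 12a − 24b + 14ab satisfies the third-order equation Ψ''' + 3P·Ψ'' + (P' + 4Q + 2P²)·Ψ' + (2Q' + 4P·Q)·Ψ = 0 at every z ∈ ℂ ∖ {0, 1, a, b} (derivatives in z). -/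
/-- Coefficient `P(z)` of the five-singular-point Fuchsian equation with singular points
`0, 1, a, b, ∞` and characteristics `(m₀, m₁, m₂, m₃; n₁ = 1)`. -/
noncomputable def Pcoef (m₁ m₂ m₃ : ℕ) (a b z : ℂ) : ℂ :=
  (1/2) * ((1 - 2*(m₁:ℂ))/z + (1 - 2*(m₂:ℂ))/(z-1) + (1 - 2*(m₃:ℂ))/(z-a)) - 2/(z-b)

/-- Coefficient `Q(z)` of the five-singular-point Fuchsian equation, with
`N = m₀ + m₁ + m₂ + m₃ + 2` and
`ρ = 2(b−1)(b−a)m₁ + 2b(b−a)m₂ + 2b(b−1)m₃ + 3b² − 2(a+1)b + a`. -/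
noncomputable def Qcoef (m₀ m₁ m₂ m₃ : ℕ) (a b lam z : ℂ) : ℂ :=
  (((m₀:ℂ) + (m₁:ℂ) + (m₂:ℂ) + (m₃:ℂ) + 2)
      * (((m₀:ℂ) + (m₁:ℂ) + (m₂:ℂ) + (m₃:ℂ) + 2) - 2*(m₀:ℂ) - 1) * z
    + lam
    + 2*(2*(b-1)*(b-a)*(m₁:ℂ) + 2*b*(b-a)*(m₂:ℂ) + 2*b*(b-1)*(m₃:ℂ)
          + 3*b^2 - 2*(a+1)*b + a) / (z-b))
  / (4*z*(z-1)*(z-a))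

/-- The third-order equation `Ψ''' + 3P·Ψ'' + (P' + 4Q + 2P²)·Ψ' + (2Q' + 4P·Q)·Ψ = 0`
satisfied by products of pairs of solutions of `y'' + P·y' + Q·y = 0`. -/
def ThirdOrderODE (P Q Ψ : ℂ → ℂ) (z : ℂ) : Prop :=
  deriv (deriv (deriv Ψ)) z + 3 * P z * deriv (deriv Ψ) z
    + (deriv P z + 4 * Q z + 2 * (P z)^2) * deriv Ψ z
    + (2 * deriv Q z + 4 * P z * Q z) * Ψ z = 0

theorem hasDerivAt_Pcoef_zero (a b z : ℂ) (h0 : z ≠ 0) (h1 : z - 1 ≠ 0) (h2 : z - a ≠ 0)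
    (h3 : z - b ≠ 0) :
    HasDerivAt (Pcoef 0 0 0 a b)
      (-(1/2) * (1/z^2 + 1/(z-1)^2 + 1/(z-a)^2) + 2/(z-b)^2) z := by
  have hid := hasDerivAt_id z
  have H := ((((hid.inv h0).add ((hid.sub_const 1).inv h1)).add
    ((hid.sub_const a).inv h2)).const_mul (1/2)).sub (((hid.sub_const b).inv h3).const_mul 2)
  refine (H.congr_deriv ?_).congr_of_eventuallyEq (.of_forall fun t => ?_)
  · simp only [id]
    ring
  · simp only [Pcoef, id, Pi.add_apply, Pi.sub_apply, Pi.inv_apply]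
    push_cast
    ring

theorem hasDerivAt_Qcoef_zero (a b lam z : ℂ) (h0 : z ≠ 0) (h1 : z - 1 ≠ 0) (h2 : z - a ≠ 0)
    (h3 : z - b ≠ 0) :
    HasDerivAt (Qcoef 0 0 0 0 a b lam)
      (((2 - 2*(3*b^2 - 2*(a+1)*b + a)/(z-b)^2) * (4*z*(z-1)*(z-a))
        - (2*z + lam + 2*(3*b^2 - 2*(a+1)*b + a)/(z-b))
          * (4*((z-1)*(z-a) + z*(z-a) + z*(z-1)))) / (4*z*(z-1)*(z-a))^2) z := by
  have hid := hasDerivAt_id z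
  have H := (((hid.const_mul 2).add_const lam).add
    (((hid.sub_const b).inv h3).const_mul (2*(3*b^2 - 2*(a+1)*b + a)))).div
    (((hid.const_mul 4).mul (hid.sub_const 1)).mul (hid.sub_const a))
    (mul_ne_zero (mul_ne_zero (mul_ne_zero (by norm_num) h0) h1) h2)
  refine (H.congr_deriv ?_).congr_of_eventuallyEq (.of_forall fun t => ?_)
  · simp only [id, Pi.add_apply, Pi.mul_apply, Pi.inv_apply]
    congr 1
    ring
  · simp only [Qcoef, id, Pi.add_apply, Pi.mul_apply, Pi.div_apply, Pi.inv_apply]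
    push_cast
    congr 1
    ring

theorem hasDerivAt_quadratic (A B C z : ℂ) :
    HasDerivAt (fun t => A * t^2 + B * t + C) (2 * A * z + B) z := by
  have H := ((((hasDerivAt_id z).pow 2).const_mul A).add
    ((hasDerivAt_id z).const_mul B)).add_const C
  refine (H.congr_deriv ?_).congr_of_eventuallyEq (.of_forall fun t => ?_)
  · simp only [id]
    push_cast
    ring
  · simp

theorem deriv_quadratic (A B C : ℂ) :
    deriv (fun t => A * t^2 + B * t + C) = fun t => 2 * A * t + B :=
  funext fun z => (hasDerivAt_quadratic A B C z).deriv

theorem deriv_linear (A B : ℂ) : deriv (fun t => A * t + B) = fun _ => A := by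
  simp

theorem fuchsian_psi_0000_b2_sub_2b_add_a (a b : ℂ) (ha0 : a ≠ 0) (ha1 : a ≠ 1) (hb0 : b ≠ 0) (hb1 : b ≠ 1) (hba : b ≠ a)
    (hb : b^2 - 2*b + a = 0) :
    ∀ lam : ℂ, ∀ z : ℂ, z ≠ 0 → z ≠ 1 → z ≠ a → z ≠ b →
      ThirdOrderODE (Pcoef 0 0 0 a b) (Qcoef 0 0 0 0 a b lam)
        (fun t => (t - b)^2 * lam + (3*a - 4*b) * t^2 - 2*(6*a + 5*a*b - 12*b) * t
          - 3*a^2 + 12*a - 24*b + 14*a*b) z := by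
  intro lam z h0 h1 h2 h3
  have h1' : z - 1 ≠ 0 := sub_ne_zero.mpr h1
  have h2' : z - a ≠ 0 := sub_ne_zero.mpr h2
  have h3' : z - b ≠ 0 := sub_ne_zero.mpr h3
  have hΨ : (fun t => (t - b)^2 * lam + (3*a - 4*b) * t^2 - 2*(6*a + 5*a*b - 12*b) * t
        - 3*a^2 + 12*a - 24*b + 14*a*b)
      = fun t => (lam + 3*a - 4*b) * t^2 + (-2*b*lam - 2*(6*a + 5*a*b - 12*b)) * t
        + (b^2*lam - 3*a^2 + 12*a - 24*b + 14*a*b) := by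
    funext t
    ring
  rw [hΨ]
  simp only [ThirdOrderODE, deriv_quadratic, deriv_linear, deriv_const,
    (hasDerivAt_Pcoef_zero a b z h0 h1' h2' h3').deriv,
    (hasDerivAt_Qcoef_zero a b lam z h0 h1' h2' h3').deriv, Pcoef, Qcoef]
  clear hΨ
  simp only [Nat.cast_zero, mul_zero, sub_zero, zero_add, add_zero]
  field_simp
  obtain rfl : a = 2*b - b^2 := by linear_combination hb
  ring
end

section
/- Take characteristics (m₀, m₁, m₂, m₃) = (2,0,0,0) (so N = 4, N(N−2m₀−1) = −4, ρ = 3b² − 2(a+1)b + a) and assume 25b⁶ − 50(a+1)b⁵ + (24a² + 101a + 24)b⁴ − 48a(a+1)b³ + 19a²b² + 2a²(a+1)b − a³ = 0. Then for every λ ∈ ℂ the function Ψ(λ, z) = (z−b)²λ² + (3z³ + (3a+3−26b)z² + (2a − 10ab − 10b + 49b²)z + b(2a + 3ab + 3b − 22b²))λ + 9z⁴ − 48bz³ − (9a − 6ab − 6b − 115b²)z² + 2b(17a − 10ab − 10b − 61b²)z + 3a² − 59ab² + 42ab³ + 42b³ + 21b⁴ satisfies the third-order equation Ψ''' + 3P·Ψ''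 + (P' + 4Q + 2P²)·Ψ' + (2Q' + 4P·Q)·Ψ = 0 at every z ∈ ℂ ∖ {0, 1, a, b} (derivatives in z). -/
/-- The derivative of a polynomial function of degree at most four given by its coefficients. -/
lemma deriv_quartic (c₀ c₁ c₂ c₃ c₄ : ℂ) :
    deriv (fun t : ℂ => c₄ * t^4 + c₃ * t^3 + c₂ * t^2 + c₁ * t + c₀)
      = fun t => 0 * t^4 + 4 * c₄ * t^3 + 3 * c₃ * t^2 + 2 * c₂ * t + c₁ := by
  funext t
  have h := ((((((hasDerivAt_pow 4 t).const_mul c₄).add ((hasDerivAt_pow 3 t).const_mul c₃)).add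
    ((hasDerivAt_pow 2 t).const_mul c₂)).add ((hasDerivAt_id t).const_mul c₁)).add_const c₀)
  refine (h.congr_deriv ?_).deriv
  push_cast
  ring

lemma deriv_Pcoef_zero {a b z : ℂ} (h0 : z ≠ 0) (h1 : z ≠ 1) (ha : z ≠ a) (hb : z ≠ b) :
    deriv (Pcoef 0 0 0 a b) z
      = -(1/2) * (1/z^2 + 1/(z-1)^2 + 1/(z-a)^2) + 2/(z-b)^2 := by
  have hid := hasDerivAt_id z
  have hinv (c k : ℂ) (h : z ≠ c) : HasDerivAt (fun t : ℂ => k / (t - c)) (-k / (z-c)^2) z := by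
    refine ((hasDerivAt_const z k).div (hid.sub_const c) (sub_ne_zero.2 h)).congr_deriv ?_
    simp
  have h := ((((hinv 0 1 h0).add (hinv 1 1 h1)).add (hinv a 1 ha)).const_mul (1/2)).sub
    (hinv b 2 hb)
  have e : Pcoef 0 0 0 a b = fun t : ℂ =>
      (1/2) * (1 / (t - 0) + 1 / (t - 1) + 1 / (t - a)) - 2 / (t - b) := by
    funext t
    simp [Pcoef]
  rw [e]
  refine (h.congr_deriv ?_).deriv
  simp only [sub_zero]
  ring

lemma deriv_Qcoef_two {a b lam z : ℂ} (h0 : z ≠ 0) (h1 : z ≠ 1) (ha : z ≠ a) (hb : z ≠ b) :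
    deriv (Qcoef 2 0 0 0 a b lam) z
      = ((-4 - 2*(3*b^2 - 2*(a+1)*b + a)/(z-b)^2) * (4*z*(z-1)*(z-a))
          - (-4*z + lam + 2*(3*b^2 - 2*(a+1)*b + a)/(z-b))
            * (4*((z-1)*(z-a) + z*(z-a) + z*(z-1)))) / (4*z*(z-1)*(z-a))^2 := by
  have hid := hasDerivAt_id' z
  have hW : 4*z*(z-1)*(z-a) ≠ 0 := by
    simp [h0, sub_ne_zero.2 h1, sub_ne_zero.2 ha]
  have hnum := ((hid.const_mul (-4)).add_const lam).add
    ((hasDerivAt_const z (2*(3*b^2 - 2*(a+1)*b + a))).div (hid.sub_const b) (sub_ne_zero.2 hb))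
  have hden := ((hid.const_mul 4).mul (hid.sub_const 1)).mul (hid.sub_const a)
  have h := hnum.div hden hW
  have e : Qcoef 2 0 0 0 a b lam = fun t : ℂ =>
      (-4 * t + lam + 2*(3*b^2 - 2*(a+1)*b + a) / (t - b)) / (4*t*(t-1)*(t-a)) := by
    funext t
    simp only [Qcoef]
    push_cast
    ring
  rw [e]
  refine (h.congr_deriv ?_).deriv
  simp only [Pi.add_apply, Pi.mul_apply, Pi.div_apply]
  ring

theorem fuchsian_psi_2000_sextic (a b : ℂ) (ha0 : a ≠ 0) (ha1 : a ≠ 1) (hb0 : b ≠ 0) (hb1 : b ≠ 1) (hba : b ≠ a)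
    (hb : 25*b^6 - 50*(a+1)*b^5 + (24*a^2 + 101*a + 24)*b^4 - 48*a*(a+1)*b^3
      + 19*a^2*b^2 + 2*a^2*(a+1)*b - a^3 = 0) :
    ∀ lam : ℂ, ∀ z : ℂ, z ≠ 0 → z ≠ 1 → z ≠ a → z ≠ b →
      ThirdOrderODE (Pcoef 0 0 0 a b) (Qcoef 2 0 0 0 a b lam)
        (fun t => (t - b)^2 * lam^2
          + (3*t^3 + (3*a + 3 - 26*b) * t^2 + (2*a - 10*a*b - 10*b + 49*b^2) * t
              + b*(2*a + 3*a*b + 3*b - 22*b^2)) * lam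
          + 9*t^4 - 48*b*t^3 - (9*a - 6*a*b - 6*b - 115*b^2) * t^2
          + 2*b*(17*a - 10*a*b - 10*b - 61*b^2) * t
          + 3*a^2 - 59*a*b^2 + 42*a*b^3 + 42*b^3 + 21*b^4) z := by
  intro lam z h0 h1 hza hzb
  have e : (fun t : ℂ => (t - b)^2 * lam^2
          + (3*t^3 + (3*a + 3 - 26*b) * t^2 + (2*a - 10*a*b - 10*b + 49*b^2) * t
              + b*(2*a + 3*a*b + 3*b - 22*b^2)) * lam
          + 9*t^4 - 48*b*t^3 - (9*a - 6*a*b - 6*b - 115*b^2) * t^2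
          + 2*b*(17*a - 10*a*b - 10*b - 61*b^2) * t
          + 3*a^2 - 59*a*b^2 + 42*a*b^3 + 42*b^3 + 21*b^4)
      = fun t => 9 * t^4 + (3*lam - 48*b) * t^3
          + (lam^2 + (3*a + 3 - 26*b)*lam - (9*a - 6*a*b - 6*b - 115*b^2)) * t^2
          + (-2*b*lam^2 + (2*a - 10*a*b - 10*b + 49*b^2)*lam
              + 2*b*(17*a - 10*a*b - 10*b - 61*b^2)) * t
          + (b^2*lam^2 + b*(2*a + 3*a*b + 3*b - 22*b^2)*lam
              + 3*a^2 - 59*a*b^2 + 42*a*b^3 + 42*b^3 + 21*b^4) := by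
    funext t
    ring
  rw [e, ThirdOrderODE]
  simp only [deriv_quartic]
  rw [deriv_Pcoef_zero h0 h1 hza hzb, deriv_Qcoef_two h0 h1 hza hzb]
  simp only [Pcoef, Qcoef]
  have k1 := sub_ne_zero.2 h1
  have ka := sub_ne_zero.2 hza
  have kb := sub_ne_zero.2 hzb
  -- The left-hand side is the sextic divided by an explicit product of linear factors.
  trans 15 * (25*b^6 - 50*(a+1)*b^5 + (24*a^2 + 101*a + 24)*b^4 - 48*a*(a+1)*b^3
      + 19*a^2*b^2 + 2*a^2*(a+1)*b - a^3) / (z*(z-1)*(z-a)*(z-b)^2)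
  · push_cast
    field_simp
    ring
  · rw [hb]
    simp
end
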